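/- Let P = {(x,y) : y ≥ a x^{β+2}} with a > 0, β ≥ 0, and let p'', q'' be two points on ∂P with nonnegative first coordinates and vertical coordinates p_y ≤ q_y ≤ D. Then ‖q'' - p''‖² ≤ (D^{2 - 2/(β+2)} + (1/a)^{2/(β+2)}) (q_y - p_y)^{2/(β+2)}. -/

import Mathlib

/-- β-uniform convexity model: for two points on the curve `y = a x^(β+2)` (with
`a > 0`, `β ≥ 0`, `0 ≤ px ≤ qx`) whose heights satisfy `py ≤ qy ≤ D`, the squared
Euclidean distance is bounded by
`(D^(2 - 2/(β+2)) + (1/a)^(2/(β+2))) (qy - py)^(2/(β+2))`. -/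
theorem stmt8 (a β px py qx qy D : ℝ) (ha : 0 < a) (hβ : 0 ≤ β)
    (hpx : 0 ≤ px) (hpq : px ≤ qx)
    (hp : py = a * px ^ (β + 2)) (hq : qy = a * qx ^ (β + 2))
    (hpyqy : py ≤ qy) (hqD : qy ≤ D) :
    (qx - px) ^ 2 + (qy - py) ^ 2 ≤
      (D ^ (2 - 2 / (β + 2)) + (1 / a) ^ (2 / (β + 2))) * (qy - py) ^ (2 / (β + 2)) := by
  have hn : 0 < β + 2 := by linarith
  have hs : 0 ≤ 2 / (β + 2) := by positivity
  have hs' : 0 ≤ 2 - 2 / (β + 2) := by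
    have : 2 / (β + 2) ≤ 2 := by
      rw [div_le_iff₀ hn]
      linarith
    linarith
  have hx : 0 ≤ qx - px := sub_nonneg.mpr hpq
  have hh : 0 ≤ qy - py := sub_nonneg.mpr hpyqy
  have hpy : 0 ≤ py := by
    rw [hp]
    positivity
  have vertical : (qy - py) ^ 2 ≤
      D ^ (2 - 2 / (β + 2)) * (qy - py) ^ (2 / (β + 2)) := by
    calc (qy - py) ^ 2 = (qy - py) ^ (2 - 2 / (β + 2)) * (qy - py) ^ (2 / (β + 2)) := by
          rw [← Real.rpow_add_of_nonneg hh hs' hs, sub_add_cancel, Real.rpow_two]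
      _ ≤ _ := by
          gcongr
          linarith
  have horizontal : (qx - px) ^ 2 ≤
      (1 / a) ^ (2 / (β + 2)) * (qy - py) ^ (2 / (β + 2)) := by
    have superadd : (qx - px) ^ (β + 2) + px ^ (β + 2) ≤ qx ^ (β + 2) := by
      simpa using Real.add_rpow_le_rpow_add hx hpx (by linarith : 1 ≤ β + 2)
    have hle : (qx - px) ^ (β + 2) ≤ 1 / a * (qy - py) := by
      rw [one_div_mul_eq_div, le_div_iff₀ ha, hp, hq]
      nlinarith
    calc (qx - px) ^ 2 = ((qx - px) ^ (β + 2)) ^ (2 / (β + 2)) := by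
          rw [← Real.rpow_mul hx, mul_div_cancel₀ _ hn.ne', Real.rpow_two]
      _ ≤ (1 / a * (qy - py)) ^ (2 / (β + 2)) := by gcongr
      _ = _ := Real.mul_rpow (by positivity) hh
  linarith
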